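/- Let A be a π-inductive algebra and let N be the set of nilpotent elements of A. Then the common kernel K = {F ∈ H : T(F) = 0 for all T ∈ N} is invariant under π(a,b) for every a ∈ k^×, b ∈ k; moreover if N ≠ {0} contains only commuting nilpotent operators then K ≠ 0. -/

import Mathlib

open scoped BigOperators

namespace AffineInductive

variable {k : Type*} [Field k]

/-- The operator `π(a,b)` on functions `kˣ → ℂ`:
`(π(a,b)F)(a') = χ(a'·b) · F(a'·a)`. -/
noncomputable def piRep (χ : AddChar k ℂ) (a : kˣ) (b : k) :
    (kˣ → ℂ) ≃ₗ[ℂ] (kˣ → ℂ) where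
  toFun F := fun a' => χ ((a' : k) * b) * F (a' * a)
  map_add' F G := by funext a'; simp [mul_add]
  map_smul' c F := by funext a'; simp [smul_eq_mul]; ring
  invFun G := fun x => χ (-(((x * a⁻¹ : kˣ) : k) * b)) * G (x * a⁻¹)
  left_inv F := by
    funext x
    have h : χ (-(((x * a⁻¹ : kˣ) : k) * b)) * χ (((x * a⁻¹ : kˣ) : k) * b) = 1 := by
      rw [← AddChar.map_add_eq_mul]; simp
    simp only []
    rw [← mul_assoc, h, one_mul, inv_mul_cancel_right]
  right_inv G := by
    funext a'
    have h : χ (((a' : k)) * b) * χ (-(((a' * a * a⁻¹ : kˣ) : k) * b)) = 1 := by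
      rw [← AddChar.map_add_eq_mul]; simp
    simp only []
    rw [← mul_assoc, h, one_mul, mul_inv_cancel_right]

/-- The multiplication operator `m_φ`. -/
def mulOp (φ : kˣ → ℂ) : Module.End ℂ (kˣ → ℂ) where
  toFun F := fun a' => φ a' * F a'
  map_add' F G := by funext a'; simp [mul_add]
  map_smul' c F := by funext a'; simp [smul_eq_mul]; ring

/-- A `π`-inductive algebra: a commutative subalgebra of `End(H)` stable under
conjugation by every `π(a,b)`. -/
def IsInductive (χ : AddChar k ℂ) (A : Subalgebra ℂ (Module.End ℂ (kˣ → ℂ))) : Prop :=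
  (∀ T ∈ A, ∀ S ∈ A, T * S = S * T) ∧
  ∀ T ∈ A, ∀ (a : kˣ) (b : k),
    (piRep χ a b).toLinearMap * T * (piRep χ a b).symm.toLinearMap ∈ A

/-- The weight space `A_b = {T ∈ A | π(1,b') T π(1,b')⁻¹ = χ(b·b') T for all b'}`. -/
noncomputable def weightSpace (χ : AddChar k ℂ)
    (A : Subalgebra ℂ (Module.End ℂ (kˣ → ℂ))) (b : k) :
    Submodule ℂ (Module.End ℂ (kˣ → ℂ)) where
  carrier := {T | T ∈ A ∧ ∀ b' : k,
    (piRep χ 1 b').toLinearMap * T * (piRep χ 1 b').symm.toLinearMap = χ (b * b') • T}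
  add_mem' := by
    rintro T S ⟨hTA, hT⟩ ⟨hSA, hS⟩
    refine ⟨add_mem hTA hSA, fun b' => ?_⟩
    rw [mul_add, add_mul, hT b', hS b', smul_add]
  zero_mem' := ⟨zero_mem A, fun b' => by simp⟩
  smul_mem' := by
    rintro c T ⟨hTA, hT⟩
    refine ⟨A.smul_mem hTA c, fun b' => ?_⟩
    rw [mul_smul_comm, smul_mul_assoc, hT b', smul_comm]

/-- The inner product on `H`. -/
noncomputable def inn [Fintype k] [DecidableEq k] (F G : kˣ → ℂ) : ℂ :=
  ∑ a' : kˣ, F a' * (starRingEnd ℂ) (G a')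

/-- Commuting nilpotent endomorphisms of a nonzero finite-dimensional space, taken from a
commutative algebra of operators, have a common nonzero kernel vector. -/
theorem exists_ne_zero_forall_isNilpotent_apply_eq_zero {K V : Type*} [Field K]
    [AddCommGroup V] [Module K V] [FiniteDimensional K V] [Nontrivial V]
    (A : Subalgebra K (Module.End K V)) (hA : ∀ T ∈ A, ∀ S ∈ A, T * S = S * T) :
    ∃ v : V, v ≠ 0 ∧ ∀ T ∈ A, IsNilpotent T → T v = 0 := by
  have : IsArtinian A V := isArtinian_of_tower K inferInstance
  obtain ⟨W, hW, -⟩ := (eq_bot_or_exists_atom_le (⊤ : Submodule A V)).resolve_left top_ne_bot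
  obtain ⟨w, hwW, hw⟩ := W.exists_mem_ne_zero_of_ne_bot hW.1
  refine ⟨w, hw, fun T hT ⟨n, hn⟩ => ?_⟩
  let kerT : Submodule A V :=
    { carrier := {v | T v = 0}
      add_mem' := fun {u v} hu hv => by
        simp only [Set.mem_ofPred_eq] at hu hv ⊢
        rw [map_add, hu, hv, add_zero]
      zero_mem' := map_zero T
      smul_mem' := fun S v hv => by
        change T ((S : Module.End K V) v) = 0
        rw [← Module.End.mul_apply, hA T hT S S.2, Module.End.mul_apply,
          show T v = 0 from hv, map_zero] }
  have hpow (m : ℕ) : (T ^ m) w ∈ W := W.smul_mem ⟨T ^ m, pow_mem hT m⟩ hwW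
  have hne : W ⊓ kerT ≠ ⊥ := by
    intro hbot
    have key (m : ℕ) : (T ^ m) w ≠ 0 := by
      induction m with
      | zero => simpa using hw
      | succ m ih =>
        intro h
        rw [pow_succ', Module.End.mul_apply] at h
        have hmem : (T ^ m) w ∈ W ⊓ kerT := ⟨hpow m, h⟩
        rw [hbot] at hmem
        exact ih hmem
    exact key n (by rw [hn, LinearMap.zero_apply])
  have hle : W ≤ kerT := inf_eq_left.mp ((hW.le_iff_eq hne).mp inf_le_left)
  exact hle hwW

theorem piRep_symm (χ : AddChar k ℂ) (a : kˣ) (b : k) :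
    (piRep χ a b).symm = piRep χ a⁻¹ (-((a⁻¹ : kˣ) * b)) := by
  ext F x
  change χ (-(((x * a⁻¹ : kˣ) : k) * b)) * F (x * a⁻¹) =
    χ ((x : k) * -((a⁻¹ : kˣ) * b)) * F (x * a⁻¹)
  rw [Units.val_mul, mul_neg, mul_assoc]

/-- An inductive algebra is also stable under conjugation by the inverses of the `π(a,b)`. -/
theorem IsInductive.symm_conj_mem {χ : AddChar k ℂ}
    {A : Subalgebra ℂ (Module.End ℂ (kˣ → ℂ))} (hA : IsInductive χ A)
    {T : Module.End ℂ (kˣ → ℂ)} (hT : T ∈ A) (a : kˣ) (b : k) :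
    (piRep χ a b).symm.conj T ∈ A := by
  rw [piRep_symm]
  exact hA.2 T hT _ _

/-- The common kernel `K` of the nilpotent elements `N` of a `π`-inductive
algebra is invariant under every `π(a,b)`; moreover if `N ≠ {0}` (its elements commute,
being in `A`) then `K ≠ 0`. -/
theorem nilpotent_common_kernel
    {k : Type*} [Field k] [Fintype k]
    (χ : AddChar k ℂ) (hχ : χ ≠ 1)
    (A : Subalgebra ℂ (Module.End ℂ (kˣ → ℂ)))
    (hA : IsInductive χ A) :
    (∀ (a : kˣ) (b : k) (F : kˣ → ℂ),
      (∀ T ∈ A, IsNilpotent T → T F = 0) →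
        ∀ T ∈ A, IsNilpotent T → T (piRep χ a b F) = 0) ∧
    (({T : Module.End ℂ (kˣ → ℂ) | T ∈ A ∧ IsNilpotent T} ≠ {0}) →
      ∃ F : kˣ → ℂ, F ≠ 0 ∧ ∀ T ∈ A, IsNilpotent T → T F = 0) := by
  refine ⟨fun a b F hF T hT hnil => ?_, fun _ =>
    exists_ne_zero_forall_isNilpotent_apply_eq_zero A hA.1⟩
  have h := hF _ (hA.symm_conj_mem hT a b)
    (hnil.map (piRep χ a b).symm.conjRingEquiv)
  simpa [LinearEquiv.conj_apply] using h

end AffineInductive
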